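/- Let E ⊆ H(11,2) be the even weight subcode of the punctured Hadamard code of length 12. Then E is entry-faithful (X,2)-neighbour transitive if and only if X = Aut(E). Moreover, Aut(E) acts faithfully on the set of 11 entries, |Aut(E)| = 7920, and the stabiliser Aut(E)_0 of the zero codeword has order 660 and acts 2-transitively on the 11 entries. -/

import Mathlib

open Equiv

namespace NT

/-- Vertices of the Hamming graph `H(m,q)`. -/
abbrev V (m q : ℕ) := Fin m → Fin q

/-- The automorphism of `H(m,q)` determined by alphabet permutations `g` and
an entry permutation `σ`:  `α ↦ (i ↦ gᵢ (α (σ⁻¹ i)))`. -/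
def hAut (m q : ℕ) (g : Fin m → Perm (Fin q)) (σ : Perm (Fin m)) :
    Perm (V m q) where
  toFun α := fun i => g i (α (σ⁻¹ i))
  invFun α := fun i => (g (σ i))⁻¹ (α (σ i))
  left_inv α := by funext i; simp
  right_inv α := by funext i; simp

/-- The automorphism group of the Hamming graph, as a subgroup of the group of
all permutations of the vertex set:  `S_q^m ⋊ S_m`. -/
def HammingAut (m q : ℕ) : Subgroup (Perm (V m q)) where
  carrier := {x | ∃ g σ, x = hAut m q g σ}
  one_mem' := ⟨fun _ => 1, 1, by ext α i; simp [hAut]⟩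
  mul_mem' := by
    rintro x y ⟨g, σ, rfl⟩ ⟨h, τ, rfl⟩
    exact ⟨fun i => g i * h (σ⁻¹ i), σ * τ, by ext α i; simp [hAut, Perm.mul_apply]⟩
  inv_mem' := by
    rintro x ⟨g, σ, rfl⟩
    refine ⟨fun i => (g (σ i))⁻¹, σ⁻¹, ?_⟩
    ext α i
    simp [hAut, Perm.inv_def]

/-- The minimum distance of a code `C ⊆ H(m,q)`. -/
noncomputable def minDist (m q : ℕ) (C : Set (V m q)) : ℕ :=
  sInf {d | ∃ α ∈ C, ∃ β ∈ C, α ≠ β ∧ hammingDist α β = d}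

/-- The distance `d(α, C)` from a vertex to a code. -/
noncomputable def distTo (m q : ℕ) (C : Set (V m q)) (α : V m q) : ℕ :=
  sInf {d | ∃ β ∈ C, hammingDist α β = d}

/-- `C_r`, the set of vertices at distance exactly `r` from the code `C`. -/
def cell (m q : ℕ) (C : Set (V m q)) (r : ℕ) : Set (V m q) :=
  {α | distTo m q C α = r}

/-- The covering radius of a code. -/
noncomputable def covRad (m q : ℕ) (C : Set (V m q)) : ℕ :=
  sSup (Set.range (distTo m q C))

/-- `S` is an orbit of the subgroup `X ≤ Sym(V)`. -/
def IsOrbit (m q : ℕ) (X : Subgroup (Perm (V m q))) (S : Set (V m q)) : Prop :=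
  S.Nonempty ∧ (∀ x ∈ X, ∀ ν ∈ S, x ν ∈ S) ∧
    ∀ ν ∈ S, ∀ μ ∈ S, ∃ x ∈ X, x ν = μ

/-- `C` is `(X,s)`-neighbour transitive:  `X` is a group of automorphisms of the
Hamming graph and each of `C, C_1, …, C_s` is an `X`-orbit. -/
def IsNT (m q : ℕ) (X : Subgroup (Perm (V m q))) (C : Set (V m q)) (s : ℕ) : Prop :=
  X ≤ HammingAut m q ∧ IsOrbit m q X C ∧
    ∀ i, 1 ≤ i → i ≤ s → IsOrbit m q X (cell m q C i)

/-- `X` acts faithfully on the set of entries, i.e. `X ∩ S_q^m = 1`. -/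
def EntryFaithful (m q : ℕ) (X : Subgroup (Perm (V m q))) : Prop :=
  ∀ x ∈ X, (∃ g, x = hAut m q g 1) → x = 1

/-- The image of `X` in `S_m` under the entry action `μ`. -/
def entryImage (m q : ℕ) (X : Subgroup (Perm (V m q))) : Set (Perm (Fin m)) :=
  {σ | ∃ x ∈ X, ∃ g, x = hAut m q g σ}

/-- Two codes are equivalent if one is the image of the other under an
automorphism of the Hamming graph. -/
def CodeEquiv (m q : ℕ) (C C' : Set (V m q)) : Prop :=
  ∃ x ∈ HammingAut m q, x '' C = C'

/-- The repetition code: all constant tuples. -/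
def RepCode (m q : ℕ) : Set (V m q) := {α | ∃ a, α = fun _ => a}

/-- The zero vertex. -/
def zeroV (m q : ℕ) [NeZero q] : V m q := fun _ => 0

/-- The weight of a vertex: the number of nonzero entries. -/
noncomputable def wt (m q : ℕ) [NeZero q] (α : V m q) : ℕ :=
  hammingNorm α

/-- `α` covers `ν` if `α` agrees with `ν` on every nonzero entry of `ν`. -/
def Covers (m q : ℕ) [NeZero q] (α ν : V m q) : Prop :=
  ∀ i, ν i ≠ 0 → ν i = α i

/-- A `q`-ary `s-(m,k,λ)` design: a set of weight-`k` vertices such that every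
weight-`s` vertex is covered by exactly `λ` of them. -/
noncomputable def IsDesign (m q : ℕ) [NeZero q] (s k lam : ℕ) (D : Set (V m q)) : Prop :=
  (∀ α ∈ D, wt m q α = k) ∧
    ∀ ν : V m q, wt m q ν = s → {α ∈ D | Covers m q α ν}.ncard = lam

/-- `C` is `s`-regular: for each `i ≤ s` and `k ≤ m`, the number
`|Γ_k(ν) ∩ C|` is the same for all `ν ∈ C_i`. -/
def SRegular (m q : ℕ) (C : Set (V m q)) (s : ℕ) : Prop :=
  ∀ i ≤ s, ∀ k ≤ m, ∀ ν ∈ cell m q C i, ∀ μ ∈ cell m q C i,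
    {β ∈ C | hammingDist ν β = k}.ncard = {β ∈ C | hammingDist μ β = k}.ncard

/-- The automorphism group of a code: the setwise stabiliser of `C` in the
automorphism group of the Hamming graph. -/
def AutCode (m q : ℕ) (C : Set (V m q)) : Subgroup (Perm (V m q)) where
  carrier := {x | x ∈ HammingAut m q ∧ x '' C = C}
  one_mem' := ⟨(HammingAut m q).one_mem, by simp⟩
  mul_mem' := by
    rintro x y ⟨hx, hx'⟩ ⟨hy, hy'⟩
    exact ⟨mul_mem hx hy, by rw [Perm.coe_mul, Set.image_comp, hy', hx']⟩
  inv_mem' := by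
    rintro x ⟨hx, hx'⟩
    refine ⟨inv_mem hx, ?_⟩
    conv_lhs => rw [← hx']
    rw [← Set.image_comp]
    simp [Perm.inv_def]

/-- `N` is a minimal normal subgroup of the (sub)group `H`. -/
def IsMinNormalIn {G : Type*} [Group G] (H N : Subgroup G) : Prop :=
  N ≤ H ∧ N ≠ ⊥ ∧ (∀ h ∈ H, ∀ n ∈ N, h * n * h⁻¹ ∈ N) ∧
    ∀ K : Subgroup G, K ≤ H → K ≠ ⊥ →
      (∀ h ∈ H, ∀ k ∈ K, h * k * h⁻¹ ∈ K) → K ≤ N → K = N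

/-- The socle of a subgroup `H`: the subgroup generated by all minimal
normal subgroups of `H`. -/
def socleIn {G : Type*} [Group G] (H : Subgroup G) : Subgroup G :=
  ⨆ N ∈ {N : Subgroup G | IsMinNormalIn H N}, N

/-- A row of the punctured Hadamard 12 code: the binary vector whose entry at
`a ∈ F₁₁` is `1` exactly when `a - b` is a square in `F₁₁` (including `0`),
corresponding to the translate by `b` of the first row of the normalised Paley
Hadamard matrix of order 12 (with the `*` coordinate deleted, and with the
Hadamard entry `-1` encoded as `1`, `1` as `0`). -/
def hadRow (b : ZMod 11) : V 11 2 :=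
  fun i => if ∃ c : ZMod 11, c ^ 2 = ((i : ℕ) : ZMod 11) - b then 1 else 0

/-- The punctured Hadamard code of length 12 in `H(11,2)`: the zero vector and
all-ones vector (from the all-`(-1)` row of `-H₁₂` and of `H₁₂`), the eleven
weight-6 rows `hadRow b`, and their complements (the rows of `-H₁₂`). -/
def PHad : Set (V 11 2) :=
  {(fun _ => 0), (fun _ => 1)} ∪ Set.range hadRow ∪
    Set.range (fun b => (fun i => 1 - hadRow b i : V 11 2))

/-- The even weight subcode of the punctured Hadamard code of length 12: the
zero vector together with the eleven weight-6 codewords. -/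
def ESub : Set (V 11 2) :=
  insert (fun _ => 0) (Set.range hadRow)

end NT

namespace NT

/-! ### Data: two generators of the automorphism group, and words in them -/

/-- The codewords of `E` indexed by `n < 12`: the rows `hadRow n` and, last, the zero word. -/
def codeword (n : ℕ) : V 11 2 := if n < 11 then hadRow n else fun _ => 0

/-- Entry `i` of `codeword n`, read off from a packed table. -/
def codewordBit (n i : ℕ) : Bool := Nat.testBit 1700242965685225887326877160826974779 (11 * n + i)

/-- Value at `i` of the function whose values are packed as the base 16 digits of `t`. -/
def digit (t i : ℕ) : ℕ := t / 16 ^ i % 16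

/-- The cyclic shift of the entries. -/
def shiftAut : Perm (V 11 2) := hAut 11 2 (fun _ => 1) (Equiv.addRight 1)

/-- An automorphism of `E` that moves the zero codeword. -/
def moveAut : Perm (V 11 2) :=
  hAut 11 2 (fun i => if codewordBit 2 i then swap 0 1 else 1)
    { toFun := ![6, 7, 8, 3, 0, 2, 10, 1, 4, 5, 9]
      invFun := ![4, 7, 5, 3, 8, 9, 0, 1, 2, 10, 6]
      left_inv := by decide
      right_inv := by decide }

/-- Action of `shiftAut` on the entries. -/
def shiftEntry : ℕ → ℕ := digit 728121033505
/-- Action of `shiftAut` on the indices of the codewords. -/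
def shiftIndex : ℕ → ℕ := digit 194242167522081
/-- Action of `moveAut` on the entries. -/
def moveEntry : ℕ → ℕ := digit 10256820222070
/-- Action of `moveAut` on the indices of the codewords. -/
def moveIndex : ℕ → ℕ := digit 40175281575771

/-- The word `a ^ e₀ * x * a ^ e₁ * x * ⋯` with exponents `l = [e₀, e₁, …]`. -/
def word {G : Type*} [Monoid G] (a x : G) : List ℕ → G
  | [] => 1
  | e :: l => a ^ e * (x * word a x l)

/-- The composite of functions that corresponds to `word`. -/
def wordMap {α : Type*} (a x : α → α) : List ℕ → α → α
  | [] => id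
  | e :: l => a^[e] ∘ x ∘ wordMap a x l

/-- Words `w` carrying the entry `1` to any other entry and fixing `0`. Each comes with words
expressing `moveAut` through `shiftAut` and any automorphism that fixes the entry `0`, acts on the
entry `1` as `w` does and carries the zero codeword to `codeword 6`. -/
def words₁ : List (List ℕ × List (List ℕ)) :=
  [([], [[4, 7, 8, 1], [7, 7, 0, 5, 0], [2, 0, 2],
      [4, 5, 8, 4], [3, 2, 0, 4], [9, 5, 4, 6]]),
   ([0, 9], [[2, 7, 2, 1], [10, 10, 0, 1], [5, 4, 6, 1],
      [6, 2, 10, 2], [8, 3, 1, 1], [7, 9, 7, 7]]),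
   ([10, 1], [[6, 7, 8, 8], [4, 6, 3, 2], [4, 3, 1],
      [2, 8, 0], [7, 3, 8, 5], [10, 3, 0, 10]]),
   ([6, 3], [[9, 4, 3, 9], [8, 10, 8, 5], [6, 2, 10],
      [6, 7, 1, 0, 0], [0, 4, 10, 0], [9, 9, 3, 7]]),
   ([1, 6, 9], [[3, 9, 0, 2], [2, 6, 10, 3], [3, 10, 9, 4],
      [4, 0, 9], [2, 3, 8], [8, 0, 1, 3]]),
   ([3, 7], [[4, 9, 10, 1], [9, 7, 10, 0], [10, 5, 4],
      [3, 8, 5], [3, 5, 3, 7], [3, 4, 0, 0]]),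
   ([0, 1, 8], [[0, 10, 8, 1], [2, 1, 3, 2], [2, 0, 6, 0],
      [1, 10, 6, 1], [10, 0, 8, 3], [6, 4, 0, 10]]),
   ([2, 4], [[0, 9, 7, 1], [1, 3, 8], [3, 3, 6, 8],
      [5, 1, 9, 3], [3, 10, 6, 5], [1, 4, 1, 5]]),
   ([0, 7, 7], [[7, 8, 1, 3], [6, 5, 4], [0, 3, 10, 2],
      [7, 7, 1], [9, 2, 7, 7], [2, 10, 1, 9, 0]]),
   ([0, 4, 9], [[10, 8, 8, 5], [6, 8, 4, 0], [1, 1, 9, 0],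
      [9, 7, 10, 1], [7, 1, 10, 7], [4, 1, 2, 3]])]

/-- Words carrying the entry `2` to any other entry and fixing `0` and `1`. -/
def words₂ : List (List ℕ) :=
  [[], [4, 8, 2], [0, 3, 1], [7, 2], [5, 4, 6], [4, 6], [4, 5, 6], [3, 4, 4], [3, 0, 10]]

/-- Words carrying the entry `3` to any other entry and fixing `0`, `1` and `2`. -/
def words₃ : List (List ℕ) :=
  [[], [4, 7, 10, 0], [6, 5, 7, 1], [9, 10, 8, 8], [6, 7, 4, 1], [5], [5, 5], [5, 5, 5]]

/-- Words carrying the entry `1` to any other entry and fixing `0` and the zero codeword. -/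
def wordsZero : List (List ℕ) :=
  [[], [0, 9], [2, 7, 8], [5, 3, 7], [2, 5, 3], [1, 9, 2, 9], [2, 0, 1, 3], [5, 10, 1],
   [5, 2, 4], [8, 4, 0]]

/-- The vertex with nonzero entries exactly at `i` and `j`. -/
def pairVertex (i j : Fin 11) : V 11 2 := fun k => if k = i ∨ k = j then 1 else 0

/-! ### Finite verifications -/

lemma codeword_apply (n : Fin 12) (i : Fin 11) :
    codeword n i = if codewordBit n i then 1 else 0 := by
  revert n i; decide +kernel

lemma shiftAut_codeword : ∀ n < 12, shiftIndex n < 12 ∧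
    shiftAut (codeword n) = codeword (shiftIndex n) := by
  decide +kernel

lemma moveAut_codeword : ∀ n < 12, moveIndex n < 12 ∧
    moveAut (codeword n) = codeword (moveIndex n) := by
  decide +kernel

set_option synthInstance.maxSize 2000 in
set_option synthInstance.maxHeartbeats 400000 in
lemma codewordBit_rigid : ∀ c < 12, ∀ p < 11, 4 ≤ p → ∀ q < 11,
    (∀ u < 12, ∃ v < 12, codewordBit v q = (codewordBit c q ^^ codewordBit u p) ∧
      ∀ i < 4, codewordBit v i = (codewordBit c i ^^ codewordBit u i)) → c = 11 ∧ q = p := by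
  decide +kernel

lemma words₁_spec : ∀ j < 11, j ≠ 0 → ∃ w ∈ words₁,
    wordMap shiftEntry moveEntry w.1 0 = 0 ∧ wordMap shiftEntry moveEntry w.1 1 = j := by
  decide +kernel

lemma words₂_spec : ∀ j < 11, j ≠ 0 → j ≠ 1 → ∃ w ∈ words₂,
    wordMap shiftEntry moveEntry w 0 = 0 ∧ wordMap shiftEntry moveEntry w 1 = 1 ∧
      wordMap shiftEntry moveEntry w 2 = j := by
  decide +kernel

set_option synthInstance.maxSize 2000 in
set_option synthInstance.maxHeartbeats 400000 in
lemma words₃_spec : ∀ j < 11, j ≠ 0 → j ≠ 1 → j ≠ 2 → ∃ w ∈ words₃,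
    wordMap shiftEntry moveEntry w 0 = 0 ∧ wordMap shiftEntry moveEntry w 1 = 1 ∧
      wordMap shiftEntry moveEntry w 2 = 2 ∧ wordMap shiftEntry moveEntry w 3 = j := by
  decide +kernel

lemma wordsZero_spec : ∀ j < 11, j ≠ 0 → ∃ w ∈ wordsZero,
    wordMap shiftIndex moveIndex w 11 = 11 ∧
    wordMap shiftEntry moveEntry w 0 = 0 ∧ wordMap shiftEntry moveEntry w 1 = j := by
  decide +kernel

lemma shiftEntry_transitive : ∀ i < 11, ∀ j < 11, ∃ e < 11, shiftEntry^[e] i = j := by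
  decide +kernel

lemma shiftIndex_transitive : ∀ m < 11, ∀ n < 11, ∃ e < 11, shiftIndex^[e] m = n := by
  decide +kernel

lemma shiftIndex_zero : ∀ e < 11, shiftIndex^[e] 11 = 11 := by
  decide +kernel

lemma moveAut_word_spec : ∀ w₁ ∈ words₁, ∀ w₂ ∈ words₂, ∀ w₃ ∈ words₃,
    wordMap shiftIndex moveIndex w₁.1 (wordMap shiftIndex moveIndex w₂
      (wordMap shiftIndex moveIndex w₃ 11)) = 6 →
    ∃ w ∈ w₁.2, ∀ i < 4, wordMap shiftEntry (wordMap shiftEntry moveEntry w₁.1 ∘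
      wordMap shiftEntry moveEntry w₂ ∘ wordMap shiftEntry moveEntry w₃) w i = moveEntry i := by
  decide +kernel

lemma hammingDist_zero_codeword : ∀ n < 11, hammingDist (fun _ => 0) (codeword n) = 6 := by
  decide +kernel

lemma hammingDist_pairVertex_zero : ∀ i j : Fin 11,
    hammingDist (pairVertex i j) (fun _ => 0) = if i = j then 1 else 2 := by
  decide +kernel

/-! ### Entry permutations -/

lemma hAut_mul (g h : Fin 11 → Perm (Fin 2)) (σ τ : Perm (Fin 11)) :
    hAut 11 2 g σ * hAut 11 2 h τ = hAut 11 2 (fun i => g i * h (σ⁻¹ i)) (σ * τ) := by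
  ext α i; simp [hAut, Perm.mul_apply]

lemma hAut_apply_apply (g : Fin 11 → Perm (Fin 2)) (σ : Perm (Fin 11)) (α : V 11 2)
    (i : Fin 11) : hAut 11 2 g σ α (σ i) = g (σ i) (α i) := by
  simp [hAut]

/-- `x` is an automorphism of the Hamming graph permuting the entries as `σ`. -/
def HasEntryPerm (x : Perm (V 11 2)) (σ : Perm (Fin 11)) : Prop := ∃ g, x = hAut 11 2 g σ

namespace HasEntryPerm

variable {x y : Perm (V 11 2)} {σ τ : Perm (Fin 11)}

lemma one : HasEntryPerm 1 1 := ⟨fun _ => 1, by ext α i; simp [hAut]⟩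

lemma mul (hx : HasEntryPerm x σ) (hy : HasEntryPerm y τ) : HasEntryPerm (x * y) (σ * τ) := by
  obtain ⟨g, rfl⟩ := hx
  obtain ⟨h, rfl⟩ := hy
  exact ⟨_, hAut_mul g h σ τ⟩

lemma inv (hx : HasEntryPerm x σ) : HasEntryPerm x⁻¹ σ⁻¹ := by
  obtain ⟨g, rfl⟩ := hx
  refine ⟨fun i => (g (σ i))⁻¹, ?_⟩
  ext α i
  simp [hAut, Perm.inv_def]

lemma unique (hx : HasEntryPerm x σ) (hx' : HasEntryPerm x τ) : σ = τ := by
  obtain ⟨g, rfl⟩ := hx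
  obtain ⟨h, e⟩ := hx'
  ext1 i
  by_contra hne
  have h0 := congrFun (congrArg (fun z : Perm (V 11 2) => z (fun _ => 0)) e) (σ i)
  have h1 := congrFun (congrArg (fun z : Perm (V 11 2) => z (Pi.single i 1)) e) (σ i)
  have hne' : τ⁻¹ (σ i) ≠ i := fun h => hne (by rw [← Perm.inv_eq_iff_eq, h])
  have hself : σ⁻¹ (σ i) = i := by simp
  simp only [hAut, Equiv.coe_fn_mk, hself, Pi.single_eq_same, Pi.single_eq_of_ne hne'] at h0 h1
  exact absurd ((g (σ i)).injective (h1.trans h0.symm)) (by decide)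

lemma mem_hammingAut (hx : HasEntryPerm x σ) : x ∈ HammingAut 11 2 :=
  ⟨hx.choose, σ, hx.choose_spec⟩

lemma hammingDist_eq (hx : HasEntryPerm x σ) (α β : V 11 2) :
    hammingDist (x α) (x β) = hammingDist α β := by
  obtain ⟨g, rfl⟩ := hx
  unfold hammingDist
  refine (Finset.card_equiv σ fun i => ?_).symm
  simp [hAut_apply_apply]

end HasEntryPerm

/-! ### The code and its automorphisms -/

lemma codeword_eleven : codeword 11 = fun _ => 0 := by simp [codeword]

lemma mem_ESub {α : V 11 2} : α ∈ ESub ↔ ∃ n < 12, codeword n = α := by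
  constructor
  · rintro (rfl | ⟨b, rfl⟩)
    · exact ⟨11, by norm_num, codeword_eleven⟩
    · refine ⟨b.val, (ZMod.val_lt b).trans (by norm_num), ?_⟩
      simp [codeword, ZMod.val_lt b]
  · rintro ⟨n, hn, rfl⟩
    unfold codeword
    split_ifs
    · exact Or.inr ⟨_, rfl⟩
    · exact Or.inl rfl

lemma codeword_mem {n : ℕ} (hn : n < 12) : codeword n ∈ ESub := mem_ESub.2 ⟨n, hn, rfl⟩

lemma zero_mem_ESub : (fun _ => 0 : V 11 2) ∈ ESub := Or.inl rfl

lemma codeword_injOn : ∀ m < 12, ∀ n < 12, codeword m = codeword n → m = n := by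
  decide +kernel

lemma ncard_ESub : ESub.ncard = 12 := by
  have : ESub = codeword '' (Finset.range 12 : Finset ℕ) := by
    ext α; simp [mem_ESub]
  rw [this, Set.InjOn.ncard_image, Set.ncard_coe_finset, Finset.card_range]
  intro m hm n hn h
  exact codeword_injOn m (by simpa using hm) n (by simpa using hn) h

lemma mem_autCode_of_mapsTo {x : Perm (V 11 2)} (hx : x ∈ HammingAut 11 2)
    (h : ∀ α ∈ ESub, x α ∈ ESub) : x ∈ AutCode 11 2 ESub := by
  refine ⟨hx, Set.eq_of_subset_of_ncard_le ?_ ?_ (Set.toFinite _)⟩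
  · rintro _ ⟨α, hα, rfl⟩; exact h α hα
  · rw [Set.ncard_image_of_injective _ x.injective]

lemma apply_mem_ESub {x : Perm (V 11 2)} (hx : x ∈ AutCode 11 2 ESub) {α : V 11 2}
    (hα : α ∈ ESub) : x α ∈ ESub := by
  rw [← hx.2]; exact ⟨α, hα, rfl⟩

lemma perm_fin_two_apply (f : Perm (Fin 2)) (y : Fin 2) : f y = f 0 + y := by
  revert f y; decide

lemma hAut_apply_eq_add (g : Fin 11 → Perm (Fin 2)) (σ : Perm (Fin 11)) (α : V 11 2)
    (i : Fin 11) : hAut 11 2 g σ α (σ i) = hAut 11 2 g σ (fun _ => 0) (σ i) + α i := by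
  rw [hAut_apply_apply, hAut_apply_apply, perm_fin_two_apply]

/-- An entry-permuting automorphism that fixes the zero vertex only permutes the entries. -/
lemma hAut_apply_of_zero {g : Fin 11 → Perm (Fin 2)} {σ : Perm (Fin 11)}
    (h : hAut 11 2 g σ (fun _ => 0) = fun _ => 0) (α : V 11 2) (i : Fin 11) :
    hAut 11 2 g σ α (σ i) = α i := by
  rw [hAut_apply_eq_add, h, zero_add]

lemma codewordBit_eq_of_add {c u v : Fin 12} {p q : Fin 11}
    (h : codeword v q = codeword c q + codeword u p) :
    codewordBit v q = (codewordBit c q ^^ codewordBit u p) := by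
  simp only [codeword_apply] at h
  revert h
  generalize codewordBit v q = a
  generalize codewordBit c q = b
  generalize codewordBit u p = d
  revert a b d
  decide

/-- An automorphism of the code that fixes four entries is trivial. -/
lemma eq_one_of_fixes {x : Perm (V 11 2)} {σ : Perm (Fin 11)} (hx : x ∈ AutCode 11 2 ESub)
    (hσ : HasEntryPerm x σ) (hfix : ∀ i : Fin 11, (i : ℕ) < 4 → σ i = i) : x = 1 := by
  obtain ⟨g, rfl⟩ := hσ
  obtain ⟨c, hc, hc0⟩ := mem_ESub.1 (apply_mem_ESub hx zero_mem_ESub)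
  have key (p : Fin 11) (hp : 4 ≤ (p : ℕ)) : c = 11 ∧ (σ p : ℕ) = p := by
    refine codewordBit_rigid c hc p p.2 hp (σ p) (σ p).2 fun u hu => ?_
    obtain ⟨v, hv, hvu⟩ := mem_ESub.1 (apply_mem_ESub hx (codeword_mem hu))
    have hadd (i : Fin 11) : codewordBit v (σ i) = (codewordBit c (σ i) ^^ codewordBit u i) :=
      codewordBit_eq_of_add (c := ⟨c, hc⟩) (u := ⟨u, hu⟩) (v := ⟨v, hv⟩)
        (by simpa only [← hvu, ← hc0] using hAut_apply_eq_add g σ (codeword u) i)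
    refine ⟨v, hv, hadd p, fun i hi => ?_⟩
    have := hadd ⟨i, by omega⟩
    rwa [hfix _ hi] at this
  have hσ1 (p : Fin 11) : σ p = p := by
    rcases lt_or_ge (p : ℕ) 4 with hp | hp
    · exact hfix p hp
    · exact Fin.ext (key p hp).2
  have h0 : hAut 11 2 g σ (fun _ => 0) = fun _ => 0 := by
    rw [← hc0, (key 4 (by decide)).1, codeword_eleven]
  refine Equiv.ext fun α => funext fun i => ?_
  have := hAut_apply_of_zero h0 α i
  rwa [hσ1] at this

lemma eq_of_entryPerm_agree {x y : Perm (V 11 2)} {σ τ : Perm (Fin 11)}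
    (hx : x ∈ AutCode 11 2 ESub) (hy : y ∈ AutCode 11 2 ESub) (hσ : HasEntryPerm x σ)
    (hτ : HasEntryPerm y τ) (h : ∀ i : Fin 11, (i : ℕ) < 4 → σ i = τ i) : x = y := by
  have := eq_one_of_fixes (mul_mem (inv_mem hy) hx) (hτ.inv.mul hσ) fun i hi => by
    simp [h i hi]
  rw [inv_mul_eq_one] at this
  exact this.symm

/-! ### Tracking automorphisms by functions on entries and on codewords -/

/-- `x` permutes the entries as `f` and the indices of the codewords as `p`. -/
def Tracks (x : Perm (V 11 2)) (f p : ℕ → ℕ) : Prop :=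
  (∃ σ, HasEntryPerm x σ ∧ ∀ i : Fin 11, (σ i : ℕ) = f i) ∧
    ∀ n < 12, p n < 12 ∧ x (codeword n) = codeword (p n)

namespace Tracks

variable {x y : Perm (V 11 2)} {f f' p p' : ℕ → ℕ}

lemma one : Tracks 1 id id := ⟨⟨1, .one, fun _ => rfl⟩, fun _ hn => ⟨hn, rfl⟩⟩

lemma mul (hx : Tracks x f p) (hy : Tracks y f' p') : Tracks (x * y) (f ∘ f') (p ∘ p') := by
  obtain ⟨⟨σ, hσ, hf⟩, hp⟩ := hx
  obtain ⟨⟨τ, hτ, hf'⟩, hp'⟩ := hy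
  refine ⟨⟨σ * τ, hσ.mul hτ, fun i => ?_⟩, fun n hn => ?_⟩
  · simp [hf, hf']
  · exact ⟨(hp _ (hp' n hn).1).1, by simp [(hp' n hn).2, (hp _ (hp' n hn).1).2]⟩

lemma pow (hx : Tracks x f p) (e : ℕ) : Tracks (x ^ e) f^[e] p^[e] := by
  induction e with
  | zero => exact one
  | succ e ih => rw [pow_succ]; exact ih.mul hx

lemma word (hx : Tracks x f p) (hy : Tracks y f' p') (l : List ℕ) :
    Tracks (word x y l) (wordMap f f' l) (wordMap p p' l) := by
  induction l with
  | nil => exact one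
  | cons e l ih => exact (hx.pow e).mul (hy.mul ih)

lemma mem_autCode (hx : Tracks x f p) : x ∈ AutCode 11 2 ESub := by
  obtain ⟨⟨σ, hσ, -⟩, hp⟩ := hx
  refine mem_autCode_of_mapsTo hσ.mem_hammingAut fun α hα => ?_
  obtain ⟨n, hn, rfl⟩ := mem_ESub.1 hα
  exact (hp n hn).2 ▸ codeword_mem (hp n hn).1

end Tracks

lemma tracks_shiftAut : Tracks shiftAut shiftEntry shiftIndex :=
  ⟨⟨_, ⟨_, rfl⟩, by decide⟩, shiftAut_codeword⟩

lemma tracks_moveAut : Tracks moveAut moveEntry moveIndex :=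
  ⟨⟨_, ⟨_, rfl⟩, by decide⟩, moveAut_codeword⟩

lemma tracks_word (l : List ℕ) : Tracks (word shiftAut moveAut l)
    (wordMap shiftEntry moveEntry l) (wordMap shiftIndex moveIndex l) :=
  tracks_shiftAut.word tracks_moveAut l

lemma word_mem {G : Type*} [Group G] {H : Subgroup G} {a x : G} (ha : a ∈ H) (hx : x ∈ H)
    (l : List ℕ) : word a x l ∈ H := by
  induction l with
  | nil => exact one_mem _
  | cons e l ih => exact mul_mem (pow_mem ha e) (mul_mem hx ih)

/-! ### Sharp 4-transitivity on the entries -/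

lemma exists_words_agree_of_fixes_zero (σ : Perm (Fin 11)) (h0 : σ 0 = 0) :
    ∃ w₁ ∈ words₁, ∃ w₂ ∈ words₂, ∃ w₃ ∈ words₃, ∃ τ,
      HasEntryPerm (word shiftAut moveAut w₁.1 * word shiftAut moveAut w₂ *
        word shiftAut moveAut w₃) τ ∧ ∀ i : Fin 11, (i : ℕ) < 4 → τ i = σ i := by
  have eq_of_val {τ : Perm (Fin 11)} {f : ℕ → ℕ} (hf : ∀ i : Fin 11, (τ i : ℕ) = f i)
      {i j : Fin 11} (h : f i = j) : τ i = j := Fin.ext ((hf i).trans h)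
  obtain ⟨w₁, hw₁, a₀, a₁⟩ := words₁_spec (σ 1) (σ 1).2 fun h => by
    exact absurd (σ.injective ((Fin.ext h : σ 1 = 0).trans h0.symm)) (by decide)
  obtain ⟨⟨τ₁, hτ₁, hf₁⟩, -⟩ := tracks_word w₁.1
  have t₁0 : τ₁ 0 = 0 := eq_of_val hf₁ a₀
  have t₁1 : τ₁ 1 = σ 1 := eq_of_val hf₁ a₁
  set σ₁ := τ₁⁻¹ * σ with hσ₁
  have s₁0 : σ₁ 0 = 0 := by rw [hσ₁, Perm.mul_apply, h0, Perm.inv_eq_iff_eq, t₁0]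
  have s₁1 : σ₁ 1 = 1 := by rw [hσ₁, Perm.mul_apply, Perm.inv_eq_iff_eq, t₁1]
  obtain ⟨w₂, hw₂, b₀, b₁, b₂⟩ := words₂_spec (σ₁ 2) (σ₁ 2).2
    (fun h => absurd (σ₁.injective ((Fin.ext h : σ₁ 2 = 0).trans s₁0.symm)) (by decide))
    (fun h => absurd (σ₁.injective ((Fin.ext h : σ₁ 2 = 1).trans s₁1.symm)) (by decide))
  obtain ⟨⟨τ₂, hτ₂, hf₂⟩, -⟩ := tracks_word w₂
  have t₂0 : τ₂ 0 = 0 := eq_of_val hf₂ b₀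
  have t₂1 : τ₂ 1 = 1 := eq_of_val hf₂ b₁
  have t₂2 : τ₂ 2 = σ₁ 2 := eq_of_val hf₂ b₂
  set σ₂ := τ₂⁻¹ * σ₁ with hσ₂
  have s₂0 : σ₂ 0 = 0 := by rw [hσ₂, Perm.mul_apply, s₁0, Perm.inv_eq_iff_eq, t₂0]
  have s₂1 : σ₂ 1 = 1 := by rw [hσ₂, Perm.mul_apply, s₁1, Perm.inv_eq_iff_eq, t₂1]
  have s₂2 : σ₂ 2 = 2 := by rw [hσ₂, Perm.mul_apply, Perm.inv_eq_iff_eq, t₂2]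
  obtain ⟨w₃, hw₃, c₀, c₁, c₂, c₃⟩ := words₃_spec (σ₂ 3) (σ₂ 3).2
    (fun h => absurd (σ₂.injective ((Fin.ext h : σ₂ 3 = 0).trans s₂0.symm)) (by decide))
    (fun h => absurd (σ₂.injective ((Fin.ext h : σ₂ 3 = 1).trans s₂1.symm)) (by decide))
    (fun h => absurd (σ₂.injective ((Fin.ext h : σ₂ 3 = 2).trans s₂2.symm)) (by decide))
  obtain ⟨⟨τ₃, hτ₃, hf₃⟩, -⟩ := tracks_word w₃
  have t₃ (i : Fin 11) (hi : (i : ℕ) < 4) : τ₃ i = σ₂ i := by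
    obtain ⟨i, hi'⟩ := i
    simp only at hi
    interval_cases i
    · exact (eq_of_val hf₃ c₀).trans s₂0.symm
    · exact (eq_of_val hf₃ c₁).trans s₂1.symm
    · exact (eq_of_val hf₃ c₂).trans s₂2.symm
    · exact eq_of_val hf₃ c₃
  refine ⟨w₁, hw₁, w₂, hw₂, w₃, hw₃, _, (hτ₁.mul hτ₂).mul hτ₃, fun i hi => ?_⟩
  rw [Perm.mul_apply, t₃ i hi, hσ₂, hσ₁]
  simp

lemma exists_shift_agree (i j : Fin 11) :
    ∃ e < 11, ∃ τ, HasEntryPerm (shiftAut ^ e) τ ∧ τ i = j := by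
  obtain ⟨e, he, h⟩ := shiftEntry_transitive i i.2 j j.2
  obtain ⟨⟨τ, hτ, hf⟩, -⟩ := tracks_shiftAut.pow e
  exact ⟨e, he, τ, hτ, Fin.ext ((hf i).trans h)⟩

lemma exists_mem_agree {H : Subgroup (Perm (V 11 2))} (hs : shiftAut ∈ H) (hm : moveAut ∈ H)
    (σ : Perm (Fin 11)) :
    ∃ y ∈ H, ∃ τ, HasEntryPerm y τ ∧ ∀ i : Fin 11, (i : ℕ) < 4 → τ i = σ i := by
  obtain ⟨e, -, τ₀, hτ₀, h₀⟩ := exists_shift_agree 0 (σ 0)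
  obtain ⟨w₁, -, w₂, -, w₃, -, τ, hτ, h⟩ := exists_words_agree_of_fixes_zero (τ₀⁻¹ * σ)
    (by rw [Perm.mul_apply, Perm.inv_eq_iff_eq, h₀])
  refine ⟨_, mul_mem (pow_mem hs e) (mul_mem (mul_mem (word_mem hs hm _) (word_mem hs hm _))
    (word_mem hs hm _)), _, hτ₀.mul hτ, fun i hi => ?_⟩
  rw [Perm.mul_apply, h i hi]
  simp

lemma exists_entryPerm {x : Perm (V 11 2)} (hx : x ∈ AutCode 11 2 ESub) :
    ∃ σ, HasEntryPerm x σ := by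
  obtain ⟨g, σ, h⟩ := hx.1
  exact ⟨σ, g, h⟩

lemma autCode_le_of_generators_mem {H : Subgroup (Perm (V 11 2))} (hs : shiftAut ∈ H)
    (hm : moveAut ∈ H) : AutCode 11 2 ESub ≤ H := by
  intro x hx
  obtain ⟨σ, hσ⟩ := exists_entryPerm hx
  obtain ⟨y, hy, τ, hτ, h⟩ := exists_mem_agree (H := H ⊓ AutCode 11 2 ESub)
    ⟨hs, tracks_shiftAut.mem_autCode⟩ ⟨hm, tracks_moveAut.mem_autCode⟩ σ
  rw [← eq_of_entryPerm_agree hy.2 hx hτ hσ h]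
  exact hy.1

lemma card_autCode : Nat.card (AutCode 11 2 ESub) = 7920 := by
  choose σ hσ using fun x : AutCode 11 2 ESub => exists_entryPerm x.2
  have hinj : Function.Injective fun x => (Fin.castLEEmb (by norm_num : 4 ≤ 11)).trans
      (σ x).toEmbedding := by
    intro x y h
    refine Subtype.ext (eq_of_entryPerm_agree x.2 y.2 (hσ x) (hσ y) fun i hi => ?_)
    exact DFunLike.congr_fun h (⟨i, hi⟩ : Fin 4)
  have hsurj : Function.Surjective fun x => (Fin.castLEEmb (by norm_num : 4 ≤ 11)).trans
      (σ x).toEmbedding := by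
    intro e
    obtain ⟨s, hs⟩ := (Equiv.Perm.isMultiplyPretransitive (Fin 11) 4).exists_smul_eq
      (Fin.castLEEmb (by norm_num : 4 ≤ 11)) e
    obtain ⟨y, hy, τ, hτ, h⟩ := exists_mem_agree tracks_shiftAut.mem_autCode
      tracks_moveAut.mem_autCode s
    refine ⟨⟨y, hy⟩, DFunLike.ext _ _ fun i => ?_⟩
    rw [← hs]
    change σ ⟨y, hy⟩ _ = s _
    rw [(hσ ⟨y, hy⟩).unique hτ]
    exact h _ i.2
  rw [Nat.card_eq_of_bijective _ ⟨hinj, hsurj⟩, Nat.card_eq_fintype_card,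
    Fintype.card_embedding_eq]
  rfl

lemma exists_apply_eq_zero {α : V 11 2} (hα : α ∈ ESub) :
    ∃ x ∈ AutCode 11 2 ESub, x α = fun _ => 0 := by
  obtain ⟨n, hn, rfl⟩ := mem_ESub.1 hα
  rcases Nat.lt_succ_iff_lt_or_eq.1 hn with hn | rfl
  · obtain ⟨e, -, he⟩ := shiftIndex_transitive n hn 0 (by norm_num)
    have h := tracks_moveAut.mul (tracks_shiftAut.pow e)
    refine ⟨_, h.mem_autCode, ?_⟩
    rw [(h.2 n (by omega)).2, Function.comp_apply, he]
    exact codeword_eleven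
  · exact ⟨1, one_mem _, codeword_eleven⟩

lemma card_autCode_inf_stabilizer : Nat.card ↥(AutCode 11 2 ESub ⊓
    MulAction.stabilizer (Perm (V 11 2)) (zeroV 11 2)) = 660 := by
  have horb : MulAction.orbit (AutCode 11 2 ESub) (zeroV 11 2) = ESub := by
    ext α
    constructor
    · rintro ⟨x, rfl⟩
      exact apply_mem_ESub x.2 zero_mem_ESub
    · intro hα
      obtain ⟨x, hx, h⟩ := exists_apply_eq_zero hα
      refine ⟨⟨x⁻¹, inv_mem hx⟩, ?_⟩
      change x⁻¹ (zeroV 11 2) = α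
      rw [Perm.inv_eq_iff_eq, h]; rfl
  have h := Subgroup.card_mul_index (MulAction.stabilizer (AutCode 11 2 ESub) (zeroV 11 2))
  rw [MulAction.index_stabilizer, horb, ncard_ESub, card_autCode] at h
  have hst : (AutCode 11 2 ESub ⊓ MulAction.stabilizer (Perm (V 11 2)) (zeroV 11 2)).subgroupOf
      (AutCode 11 2 ESub) = MulAction.stabilizer (AutCode 11 2 ESub) (zeroV 11 2) := by
    ext x
    simp [Subgroup.mem_subgroupOf, MulAction.mem_stabilizer_iff, Subgroup.smul_def]
  rw [← Nat.card_congr (Subgroup.subgroupOfEquivOfLe inf_le_left).toEquiv, hst]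
  omega

lemma stabilizer_two_transitive {i j k l : Fin 11} (hij : i ≠ j) (hkl : k ≠ l) :
    ∃ x ∈ AutCode 11 2 ESub, x (fun _ => 0) = (fun _ => 0) ∧
      ∃ σ, HasEntryPerm x σ ∧ σ i = k ∧ σ j = l := by
  have std (i j : Fin 11) (hij : i ≠ j) : ∃ x ∈ AutCode 11 2 ESub, x (fun _ => 0) = (fun _ => 0) ∧
      ∃ σ, HasEntryPerm x σ ∧ σ 0 = i ∧ σ 1 = j := by
    obtain ⟨e, he, τ₀, hτ₀, h₀⟩ := exists_shift_agree 0 i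
    obtain ⟨w, -, hw, a₀, a₁⟩ := wordsZero_spec (τ₀⁻¹ j) (τ₀⁻¹ j).2 fun h => hij <| by
      rw [← h₀, ← (Fin.ext h : τ₀⁻¹ j = 0)]; simp
    obtain ⟨⟨τ, hτ, hf⟩, hp⟩ := tracks_word w
    refine ⟨_, mul_mem (tracks_shiftAut.pow e).mem_autCode (tracks_word w).mem_autCode, ?_,
      _, hτ₀.mul hτ, ?_, ?_⟩
    · rw [← codeword_eleven, Perm.mul_apply, (hp 11 (by norm_num)).2, hw,
        ((tracks_shiftAut.pow e).2 11 (by norm_num)).2, shiftIndex_zero e he]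
    · rw [Perm.mul_apply, (Fin.ext ((hf 0).trans a₀) : τ 0 = 0), h₀]
    · rw [Perm.mul_apply, (Fin.ext ((hf 1).trans a₁) : τ 1 = τ₀⁻¹ j)]; simp
  obtain ⟨x, hx, x0, σ, hσ, rfl, rfl⟩ := std i j hij
  obtain ⟨y, hy, y0, τ, hτ, rfl, rfl⟩ := std k l hkl
  refine ⟨_, mul_mem hy (inv_mem hx), ?_, _, hτ.mul hσ.inv, by simp, by simp⟩
  rw [Perm.mul_apply, Perm.inv_eq_iff_eq.2 x0.symm, y0]

/-! ### Entry-faithfulness and neighbour-transitivity of the full automorphism group -/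

lemma entryFaithful_autCode : EntryFaithful 11 2 (AutCode 11 2 ESub) :=
  fun _ hx hg => eq_one_of_fixes hx hg fun _ _ => rfl

lemma distTo_apply {x : Perm (V 11 2)} (hx : x ∈ AutCode 11 2 ESub) (α : V 11 2) :
    distTo 11 2 ESub (x α) = distTo 11 2 ESub α := by
  obtain ⟨σ, hσ⟩ := exists_entryPerm hx
  have hset : {d | ∃ β ∈ ESub, hammingDist (x α) β = d} =
      {d | ∃ β ∈ ESub, hammingDist α β = d} := by
    ext d
    constructor
    · rintro ⟨β, hβ, rfl⟩
      refine ⟨x⁻¹ β, apply_mem_ESub (inv_mem hx) hβ, ?_⟩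
      rw [← hσ.hammingDist_eq α]
      simp
    · rintro ⟨β, hβ, rfl⟩
      exact ⟨x β, apply_mem_ESub hx hβ, hσ.hammingDist_eq α β⟩
  unfold distTo
  rw [hset]

lemma exists_hammingDist_eq_distTo (α : V 11 2) :
    ∃ β ∈ ESub, hammingDist α β = distTo 11 2 ESub α :=
  Nat.sInf_mem (s := {d | ∃ β ∈ ESub, hammingDist α β = d}) ⟨_, _, zero_mem_ESub, rfl⟩

lemma hammingDist_pairVertex_zero_le (i j : Fin 11) :
    hammingDist (pairVertex i j) (fun _ => 0) ≤ 2 := by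
  rw [hammingDist_pairVertex_zero]; split_ifs <;> norm_num

lemma eq_zero_of_hammingDist_pairVertex_le {i j : Fin 11} {β : V 11 2} (hβ : β ∈ ESub)
    (h : hammingDist (pairVertex i j) β ≤ 2) : β = fun _ => 0 := by
  obtain ⟨n, hn, rfl⟩ := mem_ESub.1 hβ
  rcases Nat.lt_succ_iff_lt_or_eq.1 hn with hn | rfl
  · have h₁ := hammingDist_zero_codeword n hn
    have h₂ := hammingDist_triangle (fun _ => 0) (pairVertex i j) (codeword n)
    rw [hammingDist_comm _ (pairVertex i j)] at h₂
    have := hammingDist_pairVertex_zero_le i j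
    omega
  · exact codeword_eleven

lemma distTo_pairVertex (i j : Fin 11) :
    distTo 11 2 ESub (pairVertex i j) = if i = j then 1 else 2 := by
  have hle : distTo 11 2 ESub (pairVertex i j) ≤ hammingDist (pairVertex i j) (fun _ => 0) :=
    Nat.sInf_le ⟨_, zero_mem_ESub, rfl⟩
  obtain ⟨β, hβ, h⟩ := exists_hammingDist_eq_distTo (pairVertex i j)
  have := eq_zero_of_hammingDist_pairVertex_le hβ
    (h ▸ hle.trans (hammingDist_pairVertex_zero_le i j))
  rw [← h, this, hammingDist_pairVertex_zero]

lemma exists_eq_pairVertex {α : V 11 2} {r : ℕ} (hr : 1 ≤ r) (hr' : r ≤ 2)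
    (h : hammingDist α (fun _ => 0) = r) : ∃ i j, α = pairVertex i j ∧ (i = j ↔ r = 1) := by
  have hα (k : Fin 11) : α k = if α k ≠ 0 then 1 else 0 := by
    generalize α k = y
    revert y; decide
  unfold hammingDist at h
  interval_cases r
  · obtain ⟨i, hi⟩ := Finset.card_eq_one.1 h
    refine ⟨i, i, funext fun k => ?_, by simp⟩
    have := Finset.ext_iff.1 hi k
    simp only [Finset.mem_filter, Finset.mem_univ, true_and, Finset.mem_singleton] at this
    rw [hα k]
    simp only [this, pairVertex, or_self]
  · obtain ⟨i, j, hij, hi⟩ := Finset.card_eq_two.1 h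
    refine ⟨i, j, funext fun k => ?_, by simp [hij]⟩
    have := Finset.ext_iff.1 hi k
    simp only [Finset.mem_filter, Finset.mem_univ, true_and, Finset.mem_insert,
      Finset.mem_singleton] at this
    rw [hα k]
    simp only [this, pairVertex]

lemma HasEntryPerm.apply_pairVertex {x : Perm (V 11 2)} {σ : Perm (Fin 11)}
    (hσ : HasEntryPerm x σ) (h0 : x (fun _ => 0) = fun _ => 0) (i j : Fin 11) :
    x (pairVertex i j) = pairVertex (σ i) (σ j) := by
  obtain ⟨g, rfl⟩ := hσ
  funext k
  obtain ⟨k, rfl⟩ := σ.surjective k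
  rw [hAut_apply_of_zero h0]
  simp [pairVertex]

/-- Every vertex at distance one or two from the code is carried near the zero codeword. -/
lemma exists_apply_eq_pairVertex {r : ℕ} (hr : 1 ≤ r) (hr' : r ≤ 2) {α : V 11 2}
    (hα : α ∈ cell 11 2 ESub r) :
    ∃ x ∈ AutCode 11 2 ESub, ∃ i j, x α = pairVertex i j ∧ (i = j ↔ r = 1) := by
  obtain ⟨β, hβ, h⟩ := exists_hammingDist_eq_distTo α
  obtain ⟨x, hx, hx0⟩ := exists_apply_eq_zero hβ
  obtain ⟨σ, hσ⟩ := exists_entryPerm hx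
  refine ⟨x, hx, exists_eq_pairVertex hr hr' ?_⟩
  rw [← hx0, hσ.hammingDist_eq, h]
  exact hα

lemma exists_apply_pairVertex_eq {i j k l : Fin 11} (h : i = j ↔ k = l) :
    ∃ x ∈ AutCode 11 2 ESub, x (pairVertex i j) = pairVertex k l := by
  rcases eq_or_ne i j with rfl | hij
  · obtain rfl := h.1 rfl
    obtain ⟨m, hm⟩ := exists_ne i
    obtain ⟨n, hn⟩ := exists_ne k
    obtain ⟨x, hx, h0, σ, hσ, rfl, -⟩ := stabilizer_two_transitive hm.symm hn.symm
    exact ⟨x, hx, hσ.apply_pairVertex h0 _ _⟩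
  · obtain ⟨x, hx, h0, σ, hσ, rfl, rfl⟩ := stabilizer_two_transitive hij (mt h.2 hij)
    exact ⟨x, hx, hσ.apply_pairVertex h0 _ _⟩

lemma isNT_autCode : IsNT 11 2 (AutCode 11 2 ESub) ESub 2 := by
  refine ⟨fun x hx => hx.1, ⟨⟨_, zero_mem_ESub⟩, fun x hx α hα => apply_mem_ESub hx hα, ?_⟩,
    fun r hr hr' => ⟨?_, fun x hx α hα => (distTo_apply hx α).trans hα, ?_⟩⟩
  · intro α hα β hβ
    obtain ⟨x, hx, hxα⟩ := exists_apply_eq_zero hα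
    obtain ⟨y, hy, hyβ⟩ := exists_apply_eq_zero hβ
    refine ⟨y⁻¹ * x, mul_mem (inv_mem hy) hx, ?_⟩
    rw [Perm.mul_apply, Perm.inv_eq_iff_eq, hxα, hyβ]
  · interval_cases r
    · exact ⟨pairVertex 0 0, distTo_pairVertex 0 0⟩
    · exact ⟨pairVertex 0 1, distTo_pairVertex 0 1⟩
  · intro α hα β hβ
    obtain ⟨x, hx, i, j, hxα, hij⟩ := exists_apply_eq_pairVertex hr hr' hα
    obtain ⟨y, hy, k, l, hyβ, hkl⟩ := exists_apply_eq_pairVertex hr hr' hβ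
    obtain ⟨z, hz, hzij⟩ := exists_apply_pairVertex_eq (hij.trans hkl.symm)
    refine ⟨y⁻¹ * (z * x), mul_mem (inv_mem hy) (mul_mem hz hx), ?_⟩
    rw [Perm.mul_apply, Perm.mul_apply, Perm.inv_eq_iff_eq, hxα, hzij, hyβ]

/-! ### Neighbour-transitive subgroups -/

lemma le_autCode_of_isNT {X : Subgroup (Perm (V 11 2))} {s : ℕ} (h : IsNT 11 2 X ESub s) :
    X ≤ AutCode 11 2 ESub :=
  fun x hx => mem_autCode_of_mapsTo (h.1 hx) (h.2.1.2.1 x hx)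

/-- A subgroup containing the shift and moving the zero codeword is the full group. -/
lemma autCode_le_of_shiftAut_mem {H : Subgroup (Perm (V 11 2))} (hH : H ≤ AutCode 11 2 ESub)
    (hs : shiftAut ∈ H) {x : Perm (V 11 2)} (hx : x ∈ H)
    (hx0 : x (fun _ => 0) ≠ fun _ => 0) : AutCode 11 2 ESub ≤ H := by
  refine autCode_le_of_generators_mem hs ?_
  obtain ⟨n, hn, hn0⟩ := mem_ESub.1 (apply_mem_ESub (hH hx) zero_mem_ESub)
  have hn' : n < 11 := by
    rcases Nat.lt_succ_iff_lt_or_eq.1 hn with hn' | rfl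
    · exact hn'
    · exact absurd (hn0.symm.trans codeword_eleven) hx0
  obtain ⟨e, -, he⟩ := shiftIndex_transitive n hn' 6 (by norm_num)
  have hse := tracks_shiftAut.pow e
  obtain ⟨σ, hσ⟩ := exists_entryPerm (hH (mul_mem (pow_mem hs e) hx))
  obtain ⟨d, hd, ρ, hρ, hρ0⟩ := exists_shift_agree 0 (σ⁻¹ 0)
  have hsd := tracks_shiftAut.pow d
  -- normalise `x` so that it fixes the entry `0` and carries the zero codeword to `codeword 6`
  set y := shiftAut ^ e * x * shiftAut ^ d with hy
  have hyH : y ∈ H := mul_mem (mul_mem (pow_mem hs e) hx) (pow_mem hs d)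
  have hyc : y (codeword 11) = codeword 6 := by
    rw [hy, Perm.mul_apply, (hsd.2 11 (by norm_num)).2, shiftIndex_zero d hd, Perm.mul_apply,
      codeword_eleven, ← hn0, (hse.2 n hn).2, he]
  obtain ⟨w₁, hw₁, w₂, hw₂, w₃, hw₃, τ, hτ, hagree⟩ :=
    exists_words_agree_of_fixes_zero (σ * ρ) (by rw [Perm.mul_apply, hρ0]; simp)
  have hT := ((tracks_word w₁.1).mul (tracks_word w₂)).mul (tracks_word w₃)
  rw [← eq_of_entryPerm_agree (hH hyH) hT.mem_autCode (hσ.mul hρ) hτ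
    fun i hi => (hagree i hi).symm] at hT
  obtain ⟨w, -, hw⟩ := moveAut_word_spec w₁ hw₁ w₂ hw₂ w₃ hw₃
    (codeword_injOn _ (hT.2 11 (by norm_num)).1 6 (by norm_num)
      ((hT.2 11 (by norm_num)).2.symm.trans hyc))
  have hW := tracks_shiftAut.word hT w
  obtain ⟨⟨π, hπ, hπf⟩, -⟩ := id hW
  obtain ⟨⟨μ, hμ, hμf⟩, -⟩ := id tracks_moveAut
  rw [← eq_of_entryPerm_agree hW.mem_autCode tracks_moveAut.mem_autCode hπ hμ fun i hi =>
    Fin.ext ((hπf i).trans ((hw i hi).trans (hμf i).symm))]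
  exact word_mem hs hyH w

lemma orderOf_shiftAut : orderOf shiftAut = 11 := by
  obtain ⟨⟨σ, hσ, hf⟩, -⟩ := id (tracks_shiftAut.pow 11)
  obtain ⟨⟨τ, hτ, hf'⟩, -⟩ := id tracks_shiftAut
  have : Fact (Nat.Prime 11) := ⟨by norm_num⟩
  refine orderOf_eq_prime ?_ ?_
  · refine eq_one_of_fixes (tracks_shiftAut.pow 11).mem_autCode hσ fun i _ => ?_
    have : ∀ i < 11, shiftEntry^[11] i = i := by decide +kernel
    exact Fin.ext ((hf i).trans (this i i.2))
  · intro h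
    have h0 := hf' 0
    rw [(h ▸ hτ : HasEntryPerm 1 τ).unique .one] at h0
    exact absurd h0 (by decide)

/-- A neighbour-transitive group contains an element of order `11`. -/
lemma exists_orderOf_eq_of_isNT {X : Subgroup (Perm (V 11 2))} (h : IsNT 11 2 X ESub 2) :
    ∃ x ∈ X, orderOf x = 11 := by
  set K := X ⊓ MulAction.stabilizer (Perm (V 11 2)) (zeroV 11 2) with hK
  have hinj : Function.Injective fun i : Fin 11 => pairVertex i i := by
    intro i j hij
    simpa [pairVertex] using congrFun hij i
  have hcell (i : Fin 11) : pairVertex i i ∈ cell 11 2 ESub 1 := by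
    simp [cell, distTo_pairVertex]
  have horb : MulAction.orbit K (pairVertex 0 0) = Set.range fun i : Fin 11 => pairVertex i i := by
    ext α
    constructor
    · rintro ⟨⟨x, hx, hx0⟩, rfl⟩
      obtain ⟨σ, hσ⟩ := exists_entryPerm (le_autCode_of_isNT h hx)
      exact ⟨σ 0, (hσ.apply_pairVertex hx0 0 0).symm⟩
    · rintro ⟨i, rfl⟩
      obtain ⟨x, hx, hxi⟩ := (h.2.2 1 le_rfl (by norm_num)).2.2 _ (hcell 0) _ (hcell i)
      have hxA := le_autCode_of_isNT h hx
      obtain ⟨σ, hσ⟩ := exists_entryPerm hxA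
      refine ⟨⟨x, hx, ?_⟩, hxi⟩
      refine eq_zero_of_hammingDist_pairVertex_le (i := i) (j := i)
        (apply_mem_ESub hxA zero_mem_ESub) ?_
      rw [← hxi]
      change hammingDist (x _) (x fun _ => 0) ≤ 2
      rw [hσ.hammingDist_eq]
      exact hammingDist_pairVertex_zero_le 0 0
  have hdvd : 11 ∣ Nat.card K := by
    have := (MulAction.stabilizer K (pairVertex 0 0)).index_dvd_card
    rwa [MulAction.index_stabilizer, horb, ← Set.image_univ, Set.ncard_image_of_injective _ hinj,
      Set.ncard_univ, Nat.card_eq_fintype_card, Fintype.card_fin] at this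
  have : Fact (Nat.Prime 11) := ⟨by norm_num⟩
  obtain ⟨x, hx⟩ := exists_prime_orderOf_dvd_card' 11 hdvd
  exact ⟨x, x.2.1, by rwa [Subgroup.orderOf_coe]⟩

/-- Elements of order `11` generate conjugate subgroups of the automorphism group. -/
lemma exists_conj_eq_shiftAut {x : Perm (V 11 2)} (hx : x ∈ AutCode 11 2 ESub)
    (hord : orderOf x = 11) :
    ∃ g ∈ AutCode 11 2 ESub, ∃ z ∈ Subgroup.zpowers x, g * z * g⁻¹ = shiftAut := by
  have : Fact (Nat.Prime 11) := ⟨by norm_num⟩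
  have hcard (y : AutCode 11 2 ESub) (hy : orderOf (y : Perm (V 11 2)) = 11) :
      Nat.card (Subgroup.zpowers y) = 11 ^ (Nat.card (AutCode 11 2 ESub)).factorization 11 := by
    rw [Nat.card_zpowers, ← Subgroup.orderOf_coe, hy, card_autCode,
      show 7920 = 11 ^ 1 * 720 by norm_num,
      Nat.factorization_eq_of_coprime_left (by norm_num) (by norm_num)]
    rw [Nat.Prime.factorization_pow (by norm_num)]
    simp
  let P := Sylow.ofCard _ (hcard ⟨x, hx⟩ hord)
  let Q := Sylow.ofCard _ (hcard ⟨shiftAut, tracks_shiftAut.mem_autCode⟩ orderOf_shiftAut)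
  obtain ⟨g, hg⟩ := MulAction.exists_smul_eq (AutCode 11 2 ESub) P Q
  have hmem : (⟨shiftAut, tracks_shiftAut.mem_autCode⟩ : AutCode 11 2 ESub) ∈ g • P := by
    rw [hg]
    exact Subgroup.mem_zpowers _
  obtain ⟨z, hz, hgz⟩ := hmem
  obtain ⟨k, rfl⟩ := hz
  exact ⟨g, g.2, x ^ k, ⟨k, rfl⟩, congrArg Subtype.val hgz⟩

lemma eq_autCode_of_isNT {X : Subgroup (Perm (V 11 2))} (h : IsNT 11 2 X ESub 2) :
    X = AutCode 11 2 ESub := by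
  have hle := le_autCode_of_isNT h
  refine le_antisymm hle fun x hx => ?_
  obtain ⟨y, hy, hord⟩ := exists_orderOf_eq_of_isNT h
  obtain ⟨g, hg, z, hz, hgz⟩ := exists_conj_eq_shiftAut (hle hy) hord
  have hzX : z ∈ X := (Subgroup.zpowers_le.2 hy) hz
  set H := X.map (MulAut.conj g).toMonoidHom with hH
  have hHle : H ≤ AutCode 11 2 ESub := by
    rintro _ ⟨w, hw, rfl⟩
    exact mul_mem (mul_mem hg (hle hw)) (inv_mem hg)
  have hα : g⁻¹ (fun _ => 0) ∈ ESub := apply_mem_ESub (inv_mem hg) zero_mem_ESub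
  obtain ⟨β, hβ, hne⟩ : ∃ β ∈ ESub, β ≠ g⁻¹ (fun _ => 0) := by
    refine Set.exists_ne_of_one_lt_ncard ?_ _
    rw [ncard_ESub]; norm_num
  obtain ⟨w, hw, hwβ⟩ := h.2.1.2.2 _ hα _ hβ
  have hall : AutCode 11 2 ESub ≤ H := by
    refine autCode_le_of_shiftAut_mem hHle ⟨z, hzX, hgz⟩ ⟨w, hw, rfl⟩ ?_
    change g (w (g⁻¹ (fun _ => 0))) ≠ _
    rwa [hwβ, Ne, ← Perm.eq_inv_iff_eq]
  obtain ⟨u, hu, hux⟩ := hall (mul_mem (mul_mem hg hx) (inv_mem hg))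
  have : u = x := (MulAut.conj g).injective hux
  exact this ▸ hu

end NT

open NT Equiv in
/-- Lemma 4.2, first part: `E` is entry-faithful `(X,2)`-neighbour
transitive iff `X = Aut(E)`; moreover `Aut(E)` acts faithfully on the 11 entries,
`|Aut(E)| = 7920` (so `Aut(E) ≅ M₁₁`), and the stabiliser of the zero codeword has
order 660 and acts 2-transitively on the 11 entries. -/
theorem stmt_14 :
    (∀ X : Subgroup (Perm (V 11 2)),
      (IsNT 11 2 X ESub 2 ∧ EntryFaithful 11 2 X) ↔ X = AutCode 11 2 ESub) ∧
    EntryFaithful 11 2 (AutCode 11 2 ESub) ∧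
    Nat.card ↥(AutCode 11 2 ESub) = 7920 ∧
    Nat.card ↥(AutCode 11 2 ESub ⊓
      MulAction.stabilizer (Perm (V 11 2)) (zeroV 11 2)) = 660 ∧
    (∀ i j k l : Fin 11, i ≠ j → k ≠ l →
      ∃ x ∈ AutCode 11 2 ESub ⊓ MulAction.stabilizer (Perm (V 11 2)) (zeroV 11 2),
        ∃ g σ, x = hAut 11 2 g σ ∧ σ i = k ∧ σ j = l) := by
  refine ⟨fun X => ⟨fun h => eq_autCode_of_isNT h.1, ?_⟩, entryFaithful_autCode, card_autCode,
    card_autCode_inf_stabilizer, fun i j k l hij hkl => ?_⟩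
  · rintro rfl
    exact ⟨isNT_autCode, entryFaithful_autCode⟩
  · obtain ⟨x, hx, h0, σ, ⟨g, hg⟩, hi, hj⟩ := stabilizer_two_transitive hij hkl
    exact ⟨x, ⟨hx, h0⟩, g, σ, hg, hi, hj⟩
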